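/- arXiv:1903.02980 — 2 statements merged into one kernel-verified Lean document; each statement's English description precedes it below -/
import Mathlib

section
/- Let (T₁,ν₁) and (T₂,ν₂) be σ-finite measure spaces, I₁ and I₂ countable index sets, (A_i)_{i∈I₁} a family of pairwise disjoint measurable subsets of T₁ with 0 < ν₁(A_i) < ∞ for all i, (B_j)_{j∈I₂} a family of pairwise disjoint measurable subsets of T₂ with 0 < ν₂(B_j) < ∞ for all j, and c : I₁×I₂ → [0,∞). Let 0 < r₁ ≤ p₁ < ∞ and 0 < r₂ ≤ p₂ < ∞, and define F : T₁×T₂ → [0,∞] by F(x,y) := Σ_{(i,j)∈I₁×I₂} c_{ij}·1_{A_i}(x)·1_{B_j}(y). Then, with all quantities interpreted in [0,∞], (∫_{T₂} (∫_{T₁} F(x,y)^{p₁} dν₁(x))^{p₂/p₁} dν₂(y))^{1/p₂} ≤ (sup_{(i,j)∈I₁×I₂} ν₁(A_i)^{1/p₁ − 1/r₁}·ν₂(B_j)^{1/p₂ − 1/r₂}) · (∫_{T₂} (∫_{T₁} F(x,y)^{r₁} dν₁(x))^{r₂/r₁} dν₂(y))^{1/r₂}. -/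
open MeasureTheory

open scoped ENNReal NNReal

/-- A function constant on each of countably many disjoint measurable sets and zero elsewhere
integrates to the sum of its values weighted by the measures. -/
lemma lintegral_eq_tsum_of_eqOn_const {T I : Type*} [MeasurableSpace T] [Countable I]
    (μ : Measure T) {A : I → Set T} (hd : Pairwise (Function.onFun Disjoint A))
    (hm : ∀ i, MeasurableSet (A i)) {f : T → ℝ≥0∞} {g : I → ℝ≥0∞}
    (hfg : ∀ i, ∀ x ∈ A i, f x = g i) (hf0 : ∀ x, (∀ i, x ∉ A i) → f x = 0) :
    ∫⁻ x, f x ∂μ = ∑' i, g i * μ (A i) := by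
  have hind : (⋃ i, A i).indicator f = f := by
    rw [Set.indicator_eq_self]
    intro x hx
    by_contra h
    exact hx (hf0 x fun i hi => h (Set.mem_iUnion.2 ⟨i, hi⟩))
  rw [← hind, lintegral_indicator (MeasurableSet.iUnion hm), lintegral_iUnion hm hd]
  refine tsum_congr fun i => ?_
  rw [setLIntegral_congr_fun (hm i) (hfg i), setLIntegral_const]

/-- The `ℓ^p` norm is at most the `ℓ^r` norm for `r ≤ p`. -/
lemma ENNReal.tsum_rpow_rpow_one_div_antitone {I : Type*} (u : I → ℝ≥0∞) {r p : ℝ}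
    (hr : 0 < r) (hrp : r ≤ p) :
    (∑' i, u i ^ p) ^ (1 / p) ≤ (∑' i, u i ^ r) ^ (1 / r) := by
  have hp : 0 < p := hr.trans_le hrp
  set s := ∑' i, u i ^ r with hs
  have hexp : 0 ≤ (p - r) / r := div_nonneg (sub_nonneg.2 hrp) hr.le
  have hterm : ∀ i, u i ^ p ≤ u i ^ r * s ^ ((p - r) / r) := by
    intro i
    calc u i ^ p = u i ^ r * (u i ^ r) ^ ((p - r) / r) := by
          rw [← ENNReal.rpow_mul, ← ENNReal.rpow_add_of_nonneg _ _ hr.le (by positivity)]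
          congr 1
          field_simp
          ring
      _ ≤ u i ^ r * s ^ ((p - r) / r) := by
          gcongr
          exact ENNReal.le_tsum (f := fun i => u i ^ r) i
  have hsum : ∑' i, u i ^ p ≤ s ^ (p / r) := by
    calc ∑' i, u i ^ p ≤ ∑' i, u i ^ r * s ^ ((p - r) / r) := ENNReal.tsum_le_tsum hterm
      _ = s ^ (1 : ℝ) * s ^ ((p - r) / r) := by rw [ENNReal.tsum_mul_right, ENNReal.rpow_one]
      _ = s ^ (p / r) := by
          rw [← ENNReal.rpow_add_of_nonneg _ _ zero_le_one hexp]
          congr 1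
          field_simp
          ring
  calc (∑' i, u i ^ p) ^ (1 / p) ≤ (s ^ (p / r)) ^ (1 / p) := by gcongr
    _ = s ^ (1 / r) := by
        rw [← ENNReal.rpow_mul]
        congr 1
        field_simp

/-- Comparison of weighted `ℓ^p` and `ℓ^r` norms for `r ≤ p`. -/
lemma ENNReal.weighted_tsum_rpow_le {I : Type*} (u m : I → ℝ≥0∞) (hm0 : ∀ i, m i ≠ 0)
    (hm : ∀ i, m i ≠ ⊤) {r p : ℝ} (hr : 0 < r) (hrp : r ≤ p) :
    (∑' i, u i ^ p * m i) ^ (1 / p) ≤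
      (⨆ i, m i ^ (1 / p - 1 / r)) * (∑' i, u i ^ r * m i) ^ (1 / r) := by
  have hp : 0 < p := hr.trans_le hrp
  set K := ⨆ i, m i ^ (1 / p - 1 / r) with hK
  have hterm : ∀ i, u i ^ p * m i ≤ K ^ p * (u i * m i ^ (1 / r)) ^ p := by
    intro i
    calc u i ^ p * m i = (m i ^ (1 / p - 1 / r) * (u i * m i ^ (1 / r))) ^ p := by
          rw [mul_left_comm, ← ENNReal.rpow_add _ _ (hm0 i) (hm i), sub_add_cancel,
            ENNReal.mul_rpow_of_nonneg _ _ hp.le, ← ENNReal.rpow_mul,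
            one_div_mul_cancel hp.ne', ENNReal.rpow_one]
      _ ≤ (K * (u i * m i ^ (1 / r))) ^ p := by
          gcongr
          exact le_iSup (fun i => m i ^ (1 / p - 1 / r)) i
      _ = _ := ENNReal.mul_rpow_of_nonneg _ _ hp.le
  calc (∑' i, u i ^ p * m i) ^ (1 / p)
      ≤ (∑' i, K ^ p * (u i * m i ^ (1 / r)) ^ p) ^ (1 / p) := by
        exact ENNReal.rpow_le_rpow (ENNReal.tsum_le_tsum hterm) (by positivity)
    _ = K * (∑' i, (u i * m i ^ (1 / r)) ^ p) ^ (1 / p) := by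
        rw [ENNReal.tsum_mul_left, ENNReal.mul_rpow_of_nonneg _ _ (by positivity),
          ← ENNReal.rpow_mul, mul_one_div_cancel hp.ne', ENNReal.rpow_one]
    _ ≤ K * (∑' i, (u i * m i ^ (1 / r)) ^ r) ^ (1 / r) := by
        gcongr
        exact ENNReal.tsum_rpow_rpow_one_div_antitone _ hr hrp
    _ = K * (∑' i, u i ^ r * m i) ^ (1 / r) := by
        congr 3 with i
        rw [ENNReal.mul_rpow_of_nonneg _ _ hr.le, ← ENNReal.rpow_mul,
          one_div_mul_cancel hr.ne', ENNReal.rpow_one]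

/-- Mixed-norm comparison for functions constant on a grid of disjoint
rectangles: the iterated `L^{(p₁,p₂)}`-norm of
`F(x,y) = ∑_{(i,j)} c_{ij} 1_{A_i}(x) 1_{B_j}(y)` is controlled by its iterated
`L^{(r₁,r₂)}`-norm, `0 < r₁ ≤ p₁ < ∞`, `0 < r₂ ≤ p₂ < ∞`, at the cost of the supremum of
`ν₁(A_i)^{1/p₁-1/r₁} ν₂(B_j)^{1/p₂-1/r₂}`. -/
theorem mixed_norm_grid_comparison
    (T₁ T₂ : Type*) [MeasurableSpace T₁] [MeasurableSpace T₂]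
    (ν₁ : Measure T₁) (ν₂ : Measure T₂) [SigmaFinite ν₁] [SigmaFinite ν₂]
    (I₁ I₂ : Type*) [Countable I₁] [Countable I₂]
    (A : I₁ → Set T₁) (B : I₂ → Set T₂)
    (hAdisj : Pairwise (Function.onFun Disjoint A)) (hAm : ∀ i, MeasurableSet (A i))
    (hA0 : ∀ i, 0 < ν₁ (A i)) (hAfin : ∀ i, ν₁ (A i) < ⊤)
    (hBdisj : Pairwise (Function.onFun Disjoint B)) (hBm : ∀ j, MeasurableSet (B j))
    (hB0 : ∀ j, 0 < ν₂ (B j)) (hBfin : ∀ j, ν₂ (B j) < ⊤)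
    (c : I₁ × I₂ → ℝ≥0)
    (r₁ p₁ r₂ p₂ : ℝ) (hr₁ : 0 < r₁) (hrp₁ : r₁ ≤ p₁) (hr₂ : 0 < r₂) (hrp₂ : r₂ ≤ p₂)
    (F : T₁ → T₂ → ℝ≥0∞)
    (hF : ∀ x y, F x y = ∑' ij : I₁ × I₂,
      (c ij : ℝ≥0∞) * (A ij.1).indicator (fun _ => (1 : ℝ≥0∞)) x *
        (B ij.2).indicator (fun _ => (1 : ℝ≥0∞)) y) :
    (∫⁻ y, (∫⁻ x, F x y ^ p₁ ∂ν₁) ^ (p₂ / p₁) ∂ν₂) ^ (1 / p₂)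
      ≤ (⨆ ij : I₁ × I₂,
            ν₁ (A ij.1) ^ (1 / p₁ - 1 / r₁) * ν₂ (B ij.2) ^ (1 / p₂ - 1 / r₂)) *
        (∫⁻ y, (∫⁻ x, F x y ^ r₁ ∂ν₁) ^ (r₂ / r₁) ∂ν₂) ^ (1 / r₂) := by
  have hp₁ : 0 < p₁ := hr₁.trans_le hrp₁
  have hp₂ : 0 < p₂ := hr₂.trans_le hrp₂
  have hF_grid : ∀ i j, ∀ x ∈ A i, ∀ y ∈ B j, F x y = c (i, j) := by
    intro i j x hx y hy
    rw [hF, tsum_eq_single (i, j)]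
    · simp [hx, hy]
    · rintro ⟨i', j'⟩ hne
      by_cases hi : i' = i
      · have hj : j' ≠ j := fun hj => hne (by rw [hi, hj])
        simp [Set.disjoint_right.1 (hBdisj hj) hy]
      · simp [Set.disjoint_right.1 (hAdisj hi) hx]
  have hF_left : ∀ x y, (∀ i, x ∉ A i) → F x y = 0 := by
    intro x y hx
    simp [hF, hx]
  have hF_right : ∀ x y, (∀ j, y ∉ B j) → F x y = 0 := by
    intro x y hy
    simp [hF, hy]
  have hnorm : ∀ p q : ℝ, 0 < p → 0 < q →
      ∫⁻ y, (∫⁻ x, F x y ^ p ∂ν₁) ^ (q / p) ∂ν₂ =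
        ∑' j, ((∑' i, (c (i, j) : ℝ≥0∞) ^ p * ν₁ (A i)) ^ (1 / p)) ^ q * ν₂ (B j) := by
    intro p q hp hq
    refine lintegral_eq_tsum_of_eqOn_const ν₂ hBdisj hBm ?_ ?_
    · intro j y hy
      rw [← ENNReal.rpow_mul, one_div_mul_eq_div]
      congr 1
      refine lintegral_eq_tsum_of_eqOn_const ν₁ hAdisj hAm ?_ ?_
      · intro i x hx
        rw [hF_grid i j x hx y hy]
      · intro x hx
        rw [hF_left x y hx, ENNReal.zero_rpow_of_pos hp]
    · intro y hy
      simp [hF_right _ y hy, ENNReal.zero_rpow_of_pos hp, ENNReal.zero_rpow_of_pos (div_pos hq hp)]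
  have hsup : (⨆ ij : I₁ × I₂,
        ν₁ (A ij.1) ^ (1 / p₁ - 1 / r₁) * ν₂ (B ij.2) ^ (1 / p₂ - 1 / r₂)) =
      (⨆ i, ν₁ (A i) ^ (1 / p₁ - 1 / r₁)) * ⨆ j, ν₂ (B j) ^ (1 / p₂ - 1 / r₂) := by
    rw [iSup_prod, ENNReal.iSup_mul]
    simp_rw [ENNReal.mul_iSup]
  rw [hnorm p₁ p₂ hp₁ hp₂, hnorm r₁ r₂ hr₁ hr₂, hsup]
  set α := ⨆ i, ν₁ (A i) ^ (1 / p₁ - 1 / r₁)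
  set G : I₂ → ℝ≥0∞ := fun j => (∑' i, (c (i, j) : ℝ≥0∞) ^ r₁ * ν₁ (A i)) ^ (1 / r₁)
  calc (∑' j, ((∑' i, (c (i, j) : ℝ≥0∞) ^ p₁ * ν₁ (A i)) ^ (1 / p₁)) ^ p₂ * ν₂ (B j)) ^ (1 / p₂)
      ≤ (∑' j, (α * G j) ^ p₂ * ν₂ (B j)) ^ (1 / p₂) := by
        gcongr with j
        exact ENNReal.weighted_tsum_rpow_le _ _ (fun i => (hA0 i).ne') (fun i => (hAfin i).ne)
          hr₁ hrp₁
    _ = α * (∑' j, G j ^ p₂ * ν₂ (B j)) ^ (1 / p₂) := by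
        simp_rw [ENNReal.mul_rpow_of_nonneg _ _ hp₂.le, mul_assoc]
        rw [ENNReal.tsum_mul_left, ENNReal.mul_rpow_of_nonneg _ _ (by positivity),
          ← ENNReal.rpow_mul, mul_one_div_cancel hp₂.ne', ENNReal.rpow_one]
    _ ≤ _ := by
        rw [mul_assoc]
        gcongr
        exact ENNReal.weighted_tsum_rpow_le _ _ (fun j => (hB0 j).ne') (fun j => (hBfin j).ne)
          hr₂ hrp₂
end

section
/- Let d₁, d₂ ≥ 1, d := d₁ + d₂, identify ℝ^d = ℝ^{d₁}×ℝ^{d₂}, and write ι₁z₁ := (z₁,0) and ι₂z₂ := (0,z₂) for z₁ ∈ ℝ^{d₁}, z₂ ∈ ℝ^{d₂}. For every M ∈ ℕ with M ≥ 1 there exist a constant C > 0, a number K ∈ ℕ, and real numbers (c^{[k]}_1, c^{[k]}_2) for k = 0,…,K, depending only on M, d₁ and d₂, such that for every normed space X, every function h : ℝ^d → X, every x ∈ ℝ^d and every z = (z₁,z₂) ∈ ℝ^{d₁}×ℝ^{d₂}: ‖Δ^{2M}_z h(x)‖_X ≤ C·Σ_{k=0}^{K} ( ‖Δ^M_{ι₁z₁}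 h(x + c^{[k]}_1 ι₁z₁ + c^{[k]}_2 ι₂z₂)‖_X + ‖Δ^M_{ι₂z₂} h(x + c^{[k]}_1 ι₁z₁ + c^{[k]}_2 ι₂z₂)‖_X ). -/
/-- The `M`-th difference `Δ^M_h f (x) = ∑_{j=0}^M (-1)^j C(M,j) f (x + (M-j) h)` of a
function `f : E → X`. -/
def deltaM {E X : Type*} [AddCommGroup E] [AddCommGroup X]
    (M : ℕ) (h : E) (f : E → X) (x : E) : X :=
  ∑ j ∈ Finset.range (M + 1),
    ((-1 : ℤ) ^ j * (M.choose j : ℤ)) • f (x + (M - j : ℕ) • h)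

open scoped AddMonoidAlgebra

/-- The additive map `ℤ[G] → X` extending `φ : G → X` linearly. -/
noncomputable def linearExtension {G X : Type*} [AddCommGroup G] [AddCommGroup X] (φ : G → X) :
    ℤ[G] →+ X :=
  (Finsupp.linearCombination ℤ φ).toAddMonoidHom.comp
    (AddMonoidAlgebra.coeffAddEquiv (R := ℤ) (M := G)).toAddMonoidHom

lemma linearExtension_single {G X : Type*} [AddCommGroup G] [AddCommGroup X] (φ : G → X)
    (m : G) (a : ℤ) : linearExtension φ (.single m a) = a • φ m := by
  simp [linearExtension]

lemma linearExtension_single_mul_pow {G X : Type*} [AddCommGroup G] [AddCommGroup X]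
    (φ : G → X) (M : ℕ) (g m : G) (a : ℤ) :
    linearExtension φ (.single m a * (.single g 1 - 1) ^ M) = a • deltaM M g φ m := by
  rw [sub_eq_neg_add, add_pow, Finset.mul_sum, map_sum, deltaM, Finset.smul_sum]
  refine Finset.sum_congr rfl fun j _ => ?_
  have key : (AddMonoidAlgebra.single m a : ℤ[G]) *
      ((-1) ^ j * (.single g 1) ^ (M - j) * (M.choose j : ℤ[G])) =
      ((-1 : ℤ) ^ j * (M.choose j : ℤ)) • .single (m + (M - j) • g) a := by
    rw [AddMonoidAlgebra.single_pow, zsmul_eq_mul]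
    have : (AddMonoidAlgebra.single (m + (M - j) • g) a : ℤ[G]) =
        .single m a * .single ((M - j) • g) 1 := by
      rw [AddMonoidAlgebra.single_mul_single, mul_one]
    rw [this, one_pow]
    push_cast
    ring
  rw [key, map_zsmul, linearExtension_single, smul_comm]

lemma linearExtension_mul_pow {G X : Type*} [AddCommGroup G] [AddCommGroup X]
    (φ : G → X) (M : ℕ) (g : G) (p : ℤ[G]) :
    linearExtension φ (p * (.single g 1 - 1) ^ M) =
      p.coeff.sum fun m a => a • deltaM M g φ m := by
  induction p using AddMonoidAlgebra.induction_linear with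
  | zero => simp
  | add p q hp hq =>
    rw [add_mul, map_add, hp, hq, AddMonoidAlgebra.coeff_add,
      Finsupp.sum_add_index' (by simp) (by simp [add_smul])]
  | single m a => simp [linearExtension_single_mul_pow]

/-- A difference of an affine pullback is the difference along the image direction. -/
lemma deltaM_comp_const_add {G E X : Type*} [AddCommGroup G] [AddCommGroup E] [AddCommGroup X]
    (ψ : G →+ E) (f : E → X) (x : E) (M : ℕ) (g m : G) :
    deltaM M g (fun n => f (x + ψ n)) m = deltaM M (ψ g) f (x + ψ m) := by
  simp [deltaM, add_assoc]

/-- `(ab - 1)^(2M)` lies in the ideal generated by `(a - 1)^M` and `(b - 1)^M`. -/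
lemma exists_mul_sub_one_pow_eq {R : Type*} [CommRing R] (a b : R) (M : ℕ) :
    ∃ p q : R, (a * b - 1) ^ (2 * M) = p * (a - 1) ^ M + q * (b - 1) ^ M := by
  have hmem : ((a - 1) * b + (b - 1)) ^ (2 * M) ∈ Ideal.span {(a - 1) ^ M, (b - 1) ^ M} := by
    refine Ideal.add_pow_mem_of_pow_mem_of_le (m := M) (n := M) _ ?_ ?_ (by omega)
    · rw [mul_pow]
      exact Ideal.mul_mem_right _ _ (Ideal.subset_span (by simp))
    · exact Ideal.subset_span (by simp)
  obtain ⟨p, q, h⟩ := Ideal.mem_span_pair.1 hmem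
  exact ⟨p, q, by rw [h]; ring⟩

lemma norm_sum_zsmul_le {G X : Type*} [NormedAddCommGroup X] [NormedSpace ℝ X] (p : G →₀ ℤ)
    (S : Finset G) (hS : p.support ⊆ S) (D : G → X) :
    ‖p.sum fun m a => a • D m‖ ≤ (∑ m ∈ S, |(p m : ℝ)|) * ∑ m ∈ S, ‖D m‖ := by
  rw [Finsupp.sum_of_support_subset p hS _ (by simp), Finset.mul_sum]
  refine (norm_sum_le _ _).trans (Finset.sum_le_sum fun m hm => ?_)
  rw [← Int.cast_smul_eq_zsmul ℝ, norm_smul, Real.norm_eq_abs]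
  gcongr
  exact Finset.single_le_sum (f := fun m => |(p m : ℝ)|) (fun _ _ => abs_nonneg _) hm

/-- On `ℝ^d = ℝ^{d₁} × ℝ^{d₂}`, a difference of order `2M` in a general
direction `z = (z₁, z₂)` is pointwise dominated by finitely many `M`-th order differences
taken purely in the directions `(z₁, 0)` and `(0, z₂)`, at suitably shifted base points,
with constants and shifts depending only on `M`, `d₁` and `d₂`. -/
theorem higher_difference_domination
    (d₁ d₂ : ℕ) (hd₁ : 1 ≤ d₁) (hd₂ : 1 ≤ d₂) (M : ℕ) (hM : 1 ≤ M) :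
    ∃ (C : ℝ) (K : ℕ) (c₁ c₂ : Fin (K + 1) → ℝ), 0 < C ∧
      ∀ (X : Type) [NormedAddCommGroup X] [NormedSpace ℝ X],
        ∀ (h : ((Fin d₁ → ℝ) × (Fin d₂ → ℝ)) → X)
          (x : (Fin d₁ → ℝ) × (Fin d₂ → ℝ)) (z₁ : Fin d₁ → ℝ) (z₂ : Fin d₂ → ℝ),
          ‖deltaM (2 * M) (z₁, z₂) h x‖ ≤
            C * ∑ k : Fin (K + 1),
              (‖deltaM M ((z₁, 0) : (Fin d₁ → ℝ) × (Fin d₂ → ℝ)) h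
                  (x + c₁ k • ((z₁, 0) : (Fin d₁ → ℝ) × (Fin d₂ → ℝ))
                     + c₂ k • ((0, z₂) : (Fin d₁ → ℝ) × (Fin d₂ → ℝ)))‖ +
               ‖deltaM M ((0, z₂) : (Fin d₁ → ℝ) × (Fin d₂ → ℝ)) h
                  (x + c₁ k • ((z₁, 0) : (Fin d₁ → ℝ) × (Fin d₂ → ℝ))
                     + c₂ k • ((0, z₂) : (Fin d₁ → ℝ) × (Fin d₂ → ℝ)))‖) := by
  classical
  obtain ⟨p, q, hpq⟩ := exists_mul_sub_one_pow_eq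
    (.single (1, 0) 1 : ℤ[ℤ × ℤ]) (.single (0, 1) 1) M
  set S : Finset (ℤ × ℤ) := insert 0 (p.coeff.support ∪ q.coeff.support)
  have hpS : p.coeff.support ⊆ S := Finset.subset_union_left.trans (Finset.subset_insert _ _)
  have hqS : q.coeff.support ⊆ S := Finset.subset_union_right.trans (Finset.subset_insert _ _)
  obtain ⟨K, hK⟩ : ∃ K, S.card = K + 1 :=
    Nat.exists_eq_succ_of_ne_zero (Finset.card_ne_zero_of_mem (Finset.mem_insert_self _ _))
  let e := S.equivFinOfCardEq hK
  set A := ∑ m ∈ S, |(p.coeff m : ℝ)|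
  set B := ∑ m ∈ S, |(q.coeff m : ℝ)|
  have hA : 0 ≤ A := Finset.sum_nonneg fun _ _ => abs_nonneg _
  have hB : 0 ≤ B := Finset.sum_nonneg fun _ _ => abs_nonneg _
  refine ⟨1 + A + B, K, fun k => ((e.symm k).1.1 : ℝ), fun k => ((e.symm k).1.2 : ℝ),
    by positivity, ?_⟩
  intro X _ _ h x z₁ z₂
  let ψ : ℤ × ℤ →+ (Fin d₁ → ℝ) × (Fin d₂ → ℝ) :=
    (zmultiplesHom _ (z₁, 0)).coprod (zmultiplesHom _ (0, z₂))
  have hψ (n : ℤ × ℤ) : ψ n = (n.1 : ℝ) • (z₁, 0) + (n.2 : ℝ) • (0, z₂) := by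
    simp only [ψ, AddMonoidHom.coprod_apply, zmultiplesHom_apply, Int.cast_smul_eq_zsmul]
  have hψ₁ : ψ (1, 0) = (z₁, 0) := by simp [hψ]
  have hψ₂ : ψ (0, 1) = (0, z₂) := by simp [hψ]
  have hψ₃ : ψ (1, 1) = (z₁, z₂) := by simp [hψ]
  let φ : ℤ × ℤ → X := fun n => h (x + ψ n)
  have hsplit : deltaM (2 * M) (z₁, z₂) h x =
      (p.coeff.sum fun m a => a • deltaM M (1, 0) φ m) +
        q.coeff.sum fun m a => a • deltaM M (0, 1) φ m := by
    rw [← linearExtension_mul_pow, ← linearExtension_mul_pow, ← map_add, ← hpq,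
      AddMonoidAlgebra.single_mul_single]
    have := linearExtension_single_mul_pow φ (2 * M) (1, 1) 0 1
    rw [← AddMonoidAlgebra.one_def, one_mul, one_smul, deltaM_comp_const_add, hψ₃, map_zero,
      add_zero] at this
    simpa using this.symm
  set U := ∑ m ∈ S, ‖deltaM M (1, 0) φ m‖ with hU
  set V := ∑ m ∈ S, ‖deltaM M (0, 1) φ m‖ with hV
  have hU0 : 0 ≤ U := Finset.sum_nonneg fun _ _ => norm_nonneg _
  have hV0 : 0 ≤ V := Finset.sum_nonneg fun _ _ => norm_nonneg _
  have hbound : ‖deltaM (2 * M) (z₁, z₂) h x‖ ≤ (1 + A + B) * (U + V) := by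
    rw [hsplit]
    have h₁ := norm_sum_zsmul_le p.coeff S hpS (deltaM M (1, 0) φ)
    have h₂ := norm_sum_zsmul_le q.coeff S hqS (deltaM M (0, 1) φ)
    refine (norm_add_le_of_le h₁ h₂).trans ?_
    nlinarith [mul_nonneg hA hV0, mul_nonneg hB hU0]
  refine hbound.trans_eq ?_
  congr 1
  rw [hU, hV, ← Finset.sum_add_distrib, ← Finset.sum_coe_sort, ← e.symm.sum_comp]
  refine Finset.sum_congr rfl fun k _ => ?_
  simp only [φ, deltaM_comp_const_add, hψ₁, hψ₂]
  simp only [hψ, add_assoc]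
end
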